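/- arXiv:0801.3446 — 2 statements merged into one kernel-verified Lean document; each statement's English description precedes it below -/
import Mathlib

section
/- For every n ≥ 1 and every odd natural number k, every sp(n,ℝ)-invariant alternating k-linear form on V = ℝ^{2n} is zero. -/
open Matrix TensorProduct Function

noncomputable section

/-- The standard module `V = ℝ^{2n}`, with coordinates indexed by `Fin n ⊕ Fin n`
(the first `n` indices are the `x`-coordinates, the last `n` the `y`-coordinates). -/
abbrev V (n : ℕ) : Type := (Fin n ⊕ Fin n) → ℝ

/-- The standard `2n × 2n` symplectic matrix `J`. -/
def stdJ (n : ℕ) : Matrix (Fin n ⊕ Fin n) (Fin n ⊕ Fin n) ℝ :=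
  Matrix.fromBlocks 0 1 (-1) 0

/-- Membership in the real symplectic Lie algebra `sp(n, ℝ)`: `Aᵀ J + J A = 0`. -/
def IsSp (n : ℕ) (A : Matrix (Fin n ⊕ Fin n) (Fin n ⊕ Fin n) ℝ) : Prop :=
  Aᵀ * stdJ n + stdJ n * A = 0

/-- The grading element `diag(1, -1)` lies in `sp(n, ℝ)`. -/
theorem isSp_fromBlocks_one_neg_one (n : ℕ) : IsSp n (Matrix.fromBlocks 1 0 0 (-1)) := by
  simp [IsSp, stdJ, Matrix.fromBlocks_transpose, Matrix.fromBlocks_multiply,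
    Matrix.fromBlocks_add]

/-- A sum of an odd number of odd integers does not vanish. -/
theorem sum_ne_zero_of_odd {ι : Type*} [Fintype ι] (hι : Odd (Fintype.card ι)) (s : ι → ℤ)
    (hs : ∀ i, Odd (s i)) : ∑ i, s i ≠ 0 := by
  intro h
  have hmod : ((∑ i, s i : ℤ) : ZMod 2) = 1 := by
    simp [Int.cast_sum, fun i => ZMod.intCast_eq_one_iff_odd.mpr (hs i),
      ZMod.natCast_eq_one_iff_odd.mpr hι]
  simp [h] at hmod

/-- The standard basis vectors are weight vectors of the grading element, of weight `±1`. -/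
theorem fromBlocks_one_neg_one_mulVec_single (n : ℕ) (c : Fin n ⊕ Fin n) :
    (Matrix.fromBlocks 1 0 0 (-1) : Matrix (Fin n ⊕ Fin n) (Fin n ⊕ Fin n) ℝ).mulVec
      (Pi.single c 1) =
    ((Sum.elim (fun _ => 1) (fun _ => -1) c : ℤ) : ℝ) • (Pi.single c 1 : V n) := by
  ext j
  rcases c with c | c <;> rcases j with j | j <;>
    simp [Matrix.one_apply, Pi.single_apply, neg_ite]

/-- For every `n ≥ 1` and every odd `k`, every `sp(n, ℝ)`-invariant
alternating `k`-linear form on `V = ℝ^{2n}` is zero. -/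
theorem sp_invariant_alternating_odd_eq_zero (n : ℕ) (hn : 1 ≤ n) (k : ℕ) (hk : Odd k)
    (φ : V n [⋀^Fin k]→ₗ[ℝ] ℝ)
    (hφ : ∀ A, IsSp n A → ∀ v : Fin k → V n,
      ∑ i : Fin k, φ (Function.update v i (A.mulVec (v i))) = 0) :
    φ = 0 := by
  refine (Pi.basisFun ℝ (Fin n ⊕ Fin n)).ext_alternating fun c _ => ?_
  have h := hφ _ (isSp_fromBlocks_one_neg_one n) fun i => Pi.single (c i) 1
  simp only [fromBlocks_one_neg_one_mulVec_single, AlternatingMap.map_update_smul,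
    Function.update_eq_self, smul_eq_mul, ← Finset.sum_mul, ← Int.cast_sum] at h
  have hne := sum_ne_zero_of_odd (by simpa using hk)
    (fun i => (Sum.elim (fun _ => 1) (fun _ => -1) (c i) : ℤ))
    (fun i => by rcases c i with j | j <;> simp)
  simpa using (mul_eq_zero.mp h).resolve_left (Int.cast_ne_zero.mpr hne)
end
end

section
/- For every n ≥ 1 and every even natural number k ≥ 0, every sp(n,ℝ)-invariant linear map f from V = ℝ^{2n} to the space of alternating k-linear forms on V is zero; here f is called sp(n,ℝ)-invariant if f(Av)(v_1,…,v_k) + Σ_{i=1}^k f(v)(v_1,…,A v_i,…,v_k) = 0 for all A ∈ sp(n,ℝ) and all v, v_1,…,v_k ∈ V. -/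
open Matrix TensorProduct Function

noncomputable section

/-- The eigenvalues `±1` of the grading element of `sp(n, ℝ)` on the coordinate vectors of `V`. -/
def coordWeight {n : ℕ} : Fin n ⊕ Fin n → ℤ :=
  Sum.elim 1 (-1)

lemma odd_coordWeight {n : ℕ} (a : Fin n ⊕ Fin n) : Odd (coordWeight a) := by
  rcases a with a | a <;> simp [coordWeight]

lemma isSp_diagonal_coordWeight (n : ℕ) :
    IsSp n (diagonal fun a => (coordWeight a : ℝ)) := by
  ext a b
  rcases a with a | a <;> rcases b with b | b <;> by_cases h : a = b <;>
    simp [stdJ, coordWeight, diagonal_transpose, h]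

lemma diagonal_coordWeight_mulVec_single {n : ℕ} (a : Fin n ⊕ Fin n) :
    (diagonal fun a => (coordWeight a : ℝ)).mulVec (Pi.single a 1) =
      (coordWeight a : ℝ) • (Pi.single a 1 : V n) := by
  ext b
  by_cases h : b = a <;> simp [mulVec_diagonal, h]

lemma coordWeight_add_sum_ne_zero {n k : ℕ} (hk : Even k) (a : Fin n ⊕ Fin n)
    (b : Fin k → Fin n ⊕ Fin n) :
    coordWeight a + ∑ i, coordWeight (b i) ≠ 0 := by
  have hodd : ∀ c : Fin n ⊕ Fin n, (coordWeight c : ZMod 2) = 1 := fun c =>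
    (ZMod.intCast_eq_one_iff_odd).mpr (odd_coordWeight c)
  intro h
  simpa [hodd, (ZMod.natCast_eq_zero_iff_even).mpr hk] using congrArg (Int.cast : ℤ → ZMod 2) h

/-- For every `n ≥ 1` and every even `k ≥ 0`, every `sp(n, ℝ)`-invariant
linear map `f` from `V = ℝ^{2n}` to the space of alternating `k`-linear forms on `V`
is zero. -/
theorem sp_invariant_maps_to_alternating_even_eq_zero (n : ℕ) (hn : 1 ≤ n)
    (k : ℕ) (hk : Even k)
    (f : V n →ₗ[ℝ] (V n [⋀^Fin k]→ₗ[ℝ] ℝ))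
    (hf : ∀ A, IsSp n A → ∀ (v : V n) (vs : Fin k → V n),
      f (A.mulVec v) vs
        + ∑ i : Fin k, f v (Function.update vs i (A.mulVec (vs i))) = 0) :
    f = 0 := by
  refine (Pi.basisFun ℝ (Fin n ⊕ Fin n)).ext fun a =>
    Module.Basis.ext_alternating (Pi.basisFun ℝ (Fin n ⊕ Fin n)) fun b _ => ?_
  have h := hf _ (isSp_diagonal_coordWeight n) (Pi.single a 1) fun i => Pi.single (b i) 1
  simp only [diagonal_coordWeight_mulVec_single, map_smul, AlternatingMap.smul_apply,
    AlternatingMap.map_update_smul, Function.update_eq_self, smul_eq_mul,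
    ← Finset.sum_mul, ← add_mul] at h
  have hw : (coordWeight a : ℝ) + ∑ i, (coordWeight (b i) : ℝ) ≠ 0 :=
    mod_cast coordWeight_add_sum_ne_zero hk a b
  simpa using (mul_eq_zero.mp h).resolve_left hw
end
end
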